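/- Let $R, \delta > 0$ and let $Z_1,\dots,Z_k$ be random variables taking values in $(1/2, \infty)$ with $k \leq 1/(1280 R \delta^2)$, such that almost surely for each $i$, $\mathbb{E}[Z_i \mid Z_1,\dots,Z_{i-1}] \geq 1 - 1/(40k)$ and $\Pr[|Z_i - 1| \geq t \mid Z_1,\dots,Z_{i-1}] \leq R e^{-t/\delta}$ for all $t \geq 0$. Then $\Pr[\prod_{i=1}^k Z_i \leq 0.9] \leq \exp(-1/(160\delta) + Rk/2)$ if $k < 1/(160 R \delta)$, and $\leq \exp(-1/(51200 R k \delta^2))$ otherwise. -/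

import Mathlib

open MeasureTheory Finset

/-- The σ-algebra generated by `Z 0, …, Z (i-1)`. -/
def pastSigma {Ω : Type*} [MeasurableSpace Ω] (Z : ℕ → Ω → ℝ) (i : ℕ) : MeasurableSpace Ω :=
  MeasurableSpace.comap (fun ω => fun j : Fin i => Z j ω) inferInstance

theorem exp_le_one_add_self_add_sq_mul_exp_abs (y : ℝ) :
    Real.exp y ≤ 1 + y + y ^ 2 / 2 * Real.exp |y| := by
  rcases le_total 0 y with hy | hy
  · have hmono : MonotoneOn (fun y : ℝ => (1 + y) * Real.exp (-y) + y ^ 2 / 2) (Set.Ici 0) := by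
      have hd : ∀ x : ℝ, HasDerivAt (fun y : ℝ => (1 + y) * Real.exp (-y) + y ^ 2 / 2)
          (x * (1 - Real.exp (-x))) x := by
        intro x
        have h := (((hasDerivAt_id x).const_add 1).mul (hasDerivAt_neg x).exp).add
          (((hasDerivAt_id x).pow 2).div_const 2)
        convert! h using 1
        simp
        ring
      refine monotoneOn_of_deriv_nonneg (convex_Ici 0)
        (fun x _ => (hd x).continuousAt.continuousWithinAt)
        (fun x _ => (hd x).differentiableAt.differentiableWithinAt) fun x hx => ?_
      rw [interior_Ici] at hx
      have hx : 0 < x := hx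
      rw [(hd x).deriv]
      exact mul_nonneg hx.le (sub_nonneg.2 (Real.exp_le_one_iff.2 (by linarith)))
    have h := hmono (Set.mem_Ici.2 le_rfl) (Set.mem_Ici.2 hy) hy
    rw [abs_of_nonneg hy]
    have he : Real.exp (-y) * Real.exp y = 1 := by rw [← Real.exp_add]; simp
    have h' := mul_le_mul_of_nonneg_right h (Real.exp_pos y).le
    simp only [neg_zero, Real.exp_zero, add_mul, mul_assoc, he] at h'
    norm_num at h'
    linarith
  · have h1 := Real.quadratic_le_exp_of_nonneg (neg_nonneg.2 hy)
    have he : Real.exp (-y) * Real.exp y = 1 := by rw [← Real.exp_add]; simp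
    have h2 : Real.exp y ≤ 1 + y + y ^ 2 / 2 := by
      have hq : 0 < 1 + y + y ^ 2 / 2 := by nlinarith [sq_nonneg (y + 1)]
      have h3 : 1 ≤ (1 + y + y ^ 2 / 2) * Real.exp (-y) := by
        nlinarith [mul_le_mul_of_nonneg_left h1 hq.le, sq_nonneg (y ^ 2)]
      nlinarith [mul_le_mul_of_nonneg_right h3 (Real.exp_pos y).le]
    have h4 : 1 ≤ Real.exp |y| := Real.one_le_exp (abs_nonneg y)
    nlinarith [mul_le_mul_of_nonneg_left h4 (by positivity : 0 ≤ y ^ 2 / 2)]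

theorem neg_log_one_add_le {x : ℝ} (hx : -(1 / 2) < x) :
    -Real.log (1 + x) ≤ -x + x ^ 2 := by
  rw [neg_le, Real.le_log_iff_exp_le (by linarith)]
  rcases le_total 0 x with h0 | h0
  · rcases le_total 1 x with h1 | h1
    · have : Real.exp (-(-x + x ^ 2)) ≤ 1 := Real.exp_le_one_iff.2 (by nlinarith)
      linarith
    · have h := Real.add_one_le_exp (-x + x ^ 2)
      rw [Real.exp_neg]
      refine inv_le_of_inv_le₀ (by linarith) (le_trans ?_ h)
      rw [inv_le_iff_one_le_mul₀ (by linarith)]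
      nlinarith [pow_nonneg h0 3]
  · have h := Real.quadratic_le_exp_of_nonneg (show 0 ≤ -x + x ^ 2 by nlinarith)
    rw [Real.exp_neg]
    refine inv_le_of_inv_le₀ (by linarith) (le_trans ?_ h)
    rw [inv_le_iff_one_le_mul₀ (by linarith)]
    obtain ⟨u, rfl⟩ : ∃ u, x = -u := ⟨-x, by ring⟩
    have hu : 0 ≤ 1 - u - u ^ 2 - u ^ 3 := by
      nlinarith [mul_nonneg (show 0 ≤ u by linarith) (show 0 ≤ 1 / 2 - u by linarith),
        mul_nonneg (sq_nonneg u) (show 0 ≤ 1 / 2 - u by linarith)]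
    nlinarith [mul_nonneg (sq_nonneg u) hu]

theorem abs_log_one_add_le {x : ℝ} (hx : -(1 / 2) < x) : |Real.log (1 + x)| ≤ 2 * |x| := by
  have hpos : 0 < 1 + x := by linarith
  have h1 := Real.log_le_sub_one_of_pos hpos
  have h2 := Real.one_sub_inv_le_log_of_pos hpos
  rcases le_total 0 x with h0 | h0
  · have := Real.log_nonneg (show 1 ≤ 1 + x by linarith)
    rw [abs_of_nonneg this, abs_of_nonneg h0]
    linarith
  · have := Real.log_nonpos hpos.le (show 1 + x ≤ 1 by linarith)
    rw [abs_of_nonpos this, abs_of_nonpos h0]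
    have h3 : (1 + x)⁻¹ ≤ 1 - 2 * x := by
      rw [inv_le_iff_one_le_mul₀ hpos]
      nlinarith
    linarith

theorem exp_neg_mul_log_one_add_le {x l b : ℝ} (hx : -(1 / 2) < x) (hl : 0 ≤ l)
    (hlb : 2 * l ≤ b) :
    Real.exp (-l * Real.log (1 + x)) ≤
      1 - l * x + (l + 2 * l ^ 2) * (x ^ 2 * Real.exp (b * |x|)) := by
  have h1 := exp_le_one_add_self_add_sq_mul_exp_abs (-l * Real.log (1 + x))
  have h2 := mul_le_mul_of_nonneg_left (neg_log_one_add_le hx) hl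
  have h3 := abs_log_one_add_le hx
  have h4 : (-l * Real.log (1 + x)) ^ 2 / 2 ≤ 2 * l ^ 2 * x ^ 2 := by
    have : Real.log (1 + x) ^ 2 ≤ (2 * |x|) ^ 2 := by
      rw [← sq_abs]; gcongr
    rw [mul_pow, sq_abs] at this
    nlinarith [mul_le_mul_of_nonneg_left this (sq_nonneg l)]
  have h5 : Real.exp |-l * Real.log (1 + x)| ≤ Real.exp (b * |x|) := by
    rw [Real.exp_le_exp, abs_mul, abs_neg, abs_of_nonneg hl]
    nlinarith [mul_le_mul_of_nonneg_left h3 hl, mul_le_mul_of_nonneg_right hlb (abs_nonneg x)]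
  have h6 : 1 ≤ Real.exp (b * |x|) :=
    Real.one_le_exp (mul_nonneg (by linarith) (abs_nonneg x))
  have h7 := mul_le_mul h4 h5 (Real.exp_pos _).le (by positivity)
  have h8 : l * x ^ 2 ≤ l * x ^ 2 * Real.exp (b * |x|) :=
    le_mul_of_one_le_right (by positivity) h6
  linarith

theorem integral_gamma_two_three {b : ℝ} (hb : 0 < b) :
    IntegrableOn (fun t : ℝ => (2 * t + b * t ^ 2) * Real.exp (-b * t)) (Set.Ioi 0) ∧
    ∫ t in Set.Ioi (0 : ℝ), (2 * t + b * t ^ 2) * Real.exp (-b * t) = 4 / b ^ 2 := by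
  have i1 := integrableOn_rpow_mul_exp_neg_mul_rpow (s := 1) (p := 1) (by norm_num) one_pos hb
  have i2 := integrableOn_rpow_mul_exp_neg_mul_rpow (s := 2) (p := 1) (by norm_num) one_pos hb
  have e1 := integral_rpow_mul_exp_neg_mul_rpow (q := 1) (p := 1) one_pos (by norm_num) hb
  have e2 := integral_rpow_mul_exp_neg_mul_rpow (q := 2) (p := 1) one_pos (by norm_num) hb
  simp only [Real.rpow_one, Real.rpow_two] at i1 i2 e1 e2
  have hf : (fun t : ℝ => (2 * t + b * t ^ 2) * Real.exp (-b * t)) =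
      fun t => 2 * (t * Real.exp (-b * t)) + b * (t ^ 2 * Real.exp (-b * t)) := by
    ext t; ring
  rw [hf]
  refine ⟨(i1.const_mul 2).add (i2.const_mul b), ?_⟩
  rw [integral_add (i1.const_mul 2) (i2.const_mul b), integral_const_mul, integral_const_mul,
    e1, e2]
  norm_num
  field_simp
  norm_num

theorem lintegral_sq_mul_exp_le {Ω : Type*} [MeasurableSpace Ω] (ν : Measure Ω) {X : Ω → ℝ}
    (hX : Measurable X) {K b : ℝ} (hK : 0 ≤ K) (hb : 0 < b)
    (htail : ∀ t : ℝ, 0 ≤ t → ν {ω | t ≤ |X ω|} ≤ ENNReal.ofReal (K * Real.exp (-(2 * b) * t))) :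
    ∫⁻ ω, ENNReal.ofReal (X ω ^ 2 * Real.exp (b * |X ω|)) ∂ν ≤ ENNReal.ofReal (K * (4 / b ^ 2)) := by
  have hcont : Continuous fun t : ℝ => (2 * t + b * t ^ 2) * Real.exp (b * t) := by fun_prop
  have hprim : ∀ x : ℝ, ∫ t in (0 : ℝ)..x, (2 * t + b * t ^ 2) * Real.exp (b * t) =
      x ^ 2 * Real.exp (b * x) := by
    intro x
    rw [intervalIntegral.integral_eq_sub_of_hasDerivAt (f := fun t => t ^ 2 * Real.exp (b * t))
      (fun t _ => ?_) (hcont.intervalIntegrable _ _)]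
    · simp
    · have h := ((hasDerivAt_id t).pow 2).mul (((hasDerivAt_id t).const_mul b).exp)
      convert! h using 1
      simp
      ring
  have hlc := lintegral_comp_eq_lintegral_meas_le_mul ν (f := fun ω => |X ω|)
    (g := fun t => (2 * t + b * t ^ 2) * Real.exp (b * t))
    (Filter.Eventually.of_forall fun ω => abs_nonneg _) hX.abs.aemeasurable
    (fun t _ => hcont.intervalIntegrable _ _)
    (by
      filter_upwards [ae_restrict_mem measurableSet_Ioi] with t ht
      have ht : 0 < t := ht
      positivity)
  simp only [hprim, sq_abs] at hlc
  rw [hlc]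
  obtain ⟨hi, he⟩ := integral_gamma_two_three hb
  calc _ ≤ ∫⁻ t in Set.Ioi (0 : ℝ),
        ENNReal.ofReal (K * ((2 * t + b * t ^ 2) * Real.exp (-b * t))) := by
        refine setLIntegral_mono (by fun_prop) fun t ht => ?_
        have ht : 0 < t := ht
        refine (mul_le_mul_left (htail t ht.le) _).trans_eq ?_
        rw [← ENNReal.ofReal_mul (by positivity)]
        congr 1
        have : Real.exp (-b * t) = Real.exp (-(2 * b) * t) * Real.exp (b * t) := by
          rw [← Real.exp_add]; ring_nf
        rw [this]; ring
    _ = _ := by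
        rw [← he, ← integral_const_mul, ofReal_integral_eq_lintegral_ofReal (hi.const_mul K)]
        filter_upwards [ae_restrict_mem measurableSet_Ioi] with t ht
        have ht : 0 < t := ht
        positivity

theorem integral_exp_neg_mul_log_one_add_le {Ω : Type*} [MeasurableSpace Ω] (ν : Measure Ω)
    [IsFiniteMeasure ν] {X : Ω → ℝ} (hX : Measurable X) (hXhalf : ∀ ω, -(1 / 2) < X ω)
    (hXint : Integrable X ν) {R m b l : ℝ} (hR : 0 ≤ R) (hb : 0 < b) (hl : 0 ≤ l)
    (hlb : 2 * l ≤ b) (hmean : -m * ν.real Set.univ ≤ ∫ ω, X ω ∂ν)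
    (htail : ∀ t : ℝ, 0 ≤ t →
      ν.real {ω | t ≤ |X ω|} ≤ R * Real.exp (-(2 * b) * t) * ν.real Set.univ) :
    ∫ ω, Real.exp (-l * Real.log (1 + X ω)) ∂ν ≤
      Real.exp (l * m + (l + 2 * l ^ 2) * (R * (4 / b ^ 2))) * ν.real Set.univ := by
  set M := ν.real Set.univ with hM
  have hM0 : 0 ≤ M := measureReal_nonneg
  have hlin := lintegral_sq_mul_exp_le ν hX (K := R * M) (by positivity) hb (fun t ht => by
    rw [ENNReal.le_ofReal_iff_toReal_le (measure_ne_top _ _) (by positivity)]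
    refine (htail t ht).trans_eq ?_
    ring)
  have hmeas : Measurable fun ω => X ω ^ 2 * Real.exp (b * |X ω|) := by fun_prop
  have hnn : 0 ≤ᵐ[ν] fun ω => X ω ^ 2 * Real.exp (b * |X ω|) :=
    Filter.Eventually.of_forall fun ω => by positivity
  have hTint : Integrable (fun ω => X ω ^ 2 * Real.exp (b * |X ω|)) ν :=
    ⟨hmeas.aestronglyMeasurable, by
      rw [hasFiniteIntegral_iff_ofReal hnn]
      exact hlin.trans_lt ENNReal.ofReal_lt_top⟩
  have hT : ∫ ω, X ω ^ 2 * Real.exp (b * |X ω|) ∂ν ≤ R * M * (4 / b ^ 2) := by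
    rw [← ofReal_integral_eq_lintegral_ofReal hTint hnn] at hlin
    exact (ENNReal.ofReal_le_ofReal_iff (by positivity)).1 hlin
  have hi1 : Integrable (fun ω => 1 - l * X ω) ν := (integrable_const 1).sub (hXint.const_mul l)
  calc _ ≤ ∫ ω, (1 - l * X ω + (l + 2 * l ^ 2) * (X ω ^ 2 * Real.exp (b * |X ω|))) ∂ν :=
        integral_mono_of_nonneg (Filter.Eventually.of_forall fun ω => (Real.exp_pos _).le)
          (hi1.add (hTint.const_mul _))
          (Filter.Eventually.of_forall fun ω => exp_neg_mul_log_one_add_le (hXhalf ω) hl hlb)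
    _ = M - l * ∫ ω, X ω ∂ν + (l + 2 * l ^ 2) * ∫ ω, X ω ^ 2 * Real.exp (b * |X ω|) ∂ν := by
        rw [integral_add hi1 (hTint.const_mul _), integral_sub (integrable_const 1)
          (hXint.const_mul l), integral_const_mul, integral_const_mul]
        simp [hM]
    _ ≤ (l * m + (l + 2 * l ^ 2) * (R * (4 / b ^ 2)) + 1) * M := by
        have h1 := mul_le_mul_of_nonneg_left hmean hl
        have h2 := mul_le_mul_of_nonneg_left hT (show 0 ≤ l + 2 * l ^ 2 by positivity)
        linarith
    _ ≤ _ := mul_le_mul_of_nonneg_right (Real.add_one_le_exp _) hM0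

theorem integral_mul_le_of_condExp_le {Ω : Type*} {m mΩ : MeasurableSpace Ω} {μ : Measure Ω}
    [IsFiniteMeasure μ] (hm : m ≤ mΩ) {W f : Ω → ℝ} {C a : ℝ} (hW : StronglyMeasurable[m] W)
    (hW0 : ∀ ω, 0 ≤ W ω) (hWC : ∀ ω, W ω ≤ C) (hf : Integrable f μ)
    (hfa : ∀ᵐ ω ∂μ, (μ[f | m]) ω ≤ a) :
    ∫ ω, W ω * f ω ∂μ ≤ a * ∫ ω, W ω ∂μ := by
  have hbound : ∀ᵐ ω ∂μ, ‖W ω‖ ≤ C := Filter.Eventually.of_forall fun ω => by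
    rw [Real.norm_of_nonneg (hW0 ω)]; exact hWC ω
  have hpull := condExp_stronglyMeasurable_mul_of_bound hm hW hf C hbound
  have hWi : Integrable W μ := .of_bound (hW.mono hm).aestronglyMeasurable C hbound
  calc ∫ ω, W ω * f ω ∂μ = ∫ ω, (μ[W * f | m]) ω ∂μ := (integral_condExp hm).symm
    _ = ∫ ω, W ω * (μ[f | m]) ω ∂μ := integral_congr_ae hpull
    _ ≤ ∫ ω, a * W ω ∂μ := by
        refine integral_mono_ae
          (integrable_condExp.bdd_mul (hW.mono hm).aestronglyMeasurable hbound)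
          (hWi.const_mul a) ?_
        filter_upwards [hfa] with ω hω
        nlinarith [mul_le_mul_of_nonneg_left hω (hW0 ω)]
    _ = _ := integral_const_mul _ _

theorem integral_mul_exp_neg_mul_log_le {Ω : Type*} {m mΩ : MeasurableSpace Ω} {μ : Measure Ω}
    [IsFiniteMeasure μ] (hm : m ≤ mΩ) {W Z : Ω → ℝ} {C : ℝ} (hW : StronglyMeasurable[m] W)
    (hW0 : ∀ ω, 0 ≤ W ω) (hWC : ∀ ω, W ω ≤ C) (hZ : Measurable Z) (hZhalf : ∀ ω, 1 / 2 < Z ω)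
    (hZint : Integrable Z μ) {R ε b l : ℝ} (hR : 0 ≤ R) (hb : 0 < b) (hl : 0 ≤ l)
    (hlb : 2 * l ≤ b) (hmean : ∀ᵐ ω ∂μ, 1 - ε ≤ (μ[Z | m]) ω)
    (htail : ∀ t : ℝ, 0 ≤ t →
      ∀ᵐ ω ∂μ, (μ[Set.indicator {ω' | t ≤ |Z ω' - 1|} (fun _ => (1 : ℝ)) | m]) ω ≤
        R * Real.exp (-(2 * b) * t)) :
    ∫ ω, W ω * Real.exp (-l * Real.log (Z ω)) ∂μ ≤
      Real.exp (l * ε + (l + 2 * l ^ 2) * (R * (4 / b ^ 2))) * ∫ ω, W ω ∂μ := by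
  have hWm : Measurable W := (hW.mono hm).measurable
  have hbound : ∀ᵐ ω ∂μ, ‖W ω‖ ≤ C := Filter.Eventually.of_forall fun ω => by
    rw [Real.norm_of_nonneg (hW0 ω)]; exact hWC ω
  have hWi : Integrable W μ := .of_bound hWm.aestronglyMeasurable C hbound
  set ν := μ.withDensity fun ω => ENNReal.ofReal (W ω) with hν
  have hνint : ∀ g : Ω → ℝ, ∫ ω, g ω ∂ν = ∫ ω, W ω * g ω ∂μ := by
    intro g
    rw [hν, integral_withDensity_eq_integral_toReal_smul hWm.ennreal_ofReal
      (Filter.Eventually.of_forall fun _ => ENNReal.ofReal_lt_top)]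
    simp only [ENNReal.toReal_ofReal (hW0 _), smul_eq_mul]
  have : IsFiniteMeasure ν := isFiniteMeasure_withDensity_ofReal hWi.2
  have hνreal : ∀ s, MeasurableSet s →
      ν.real s = ∫ ω, W ω * s.indicator (fun _ => (1 : ℝ)) ω ∂μ := by
    intro s hs
    rw [← hνint, integral_indicator_const _ hs]
    simp
  have hνuniv : ν.real Set.univ = ∫ ω, W ω ∂μ := by
    rw [hνreal _ .univ]; simp
  have hXint : Integrable (fun ω => Z ω - 1) ν := by
    rw [hν, integrable_withDensity_iff_integrable_smul' hWm.ennreal_ofReal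
      (Filter.Eventually.of_forall fun _ => ENNReal.ofReal_lt_top)]
    simp only [ENNReal.toReal_ofReal (hW0 _), smul_eq_mul]
    exact (hZint.sub (integrable_const 1)).bdd_mul hWm.aestronglyMeasurable hbound
  have hX := integral_exp_neg_mul_log_one_add_le ν (X := fun ω => Z ω - 1) (hZ.sub_const 1)
    (fun ω => by linarith [hZhalf ω]) hXint (m := ε) hR hb hl hlb ?_ ?_
  · simpa only [add_sub_cancel, hνint, hνuniv] using hX
  · rw [hνuniv, hνint]
    have h := integral_mul_le_of_condExp_le hm hW hW0 hWC
      (f := fun ω => -(Z ω)) (a := -(1 - ε)) hZint.neg (by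
        filter_upwards [hmean, condExp_neg Z m (μ := μ)] with ω h1 h2
        have h3 : (μ[fun ω => -(Z ω) | m]) ω = -(μ[Z | m]) ω := h2
        rw [h3]
        exact neg_le_neg h1)
    simp only [mul_neg, integral_neg] at h
    have hZW : Integrable (fun ω => W ω * Z ω) μ :=
      hZint.bdd_mul hWm.aestronglyMeasurable hbound
    simp only [mul_sub, mul_one]
    rw [integral_sub hZW hWi]
    linarith
  · intro t ht
    have hs : MeasurableSet {ω | t ≤ |Z ω - 1|} :=
      measurableSet_le measurable_const (hZ.sub_const 1).abs
    rw [hνuniv, hνreal _ hs]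
    exact integral_mul_le_of_condExp_le hm hW hW0 hWC ((integrable_const 1).indicator hs)
      (htail t ht)

theorem pastSigma_le {Ω : Type*} [mΩ : MeasurableSpace Ω] {Z : ℕ → Ω → ℝ}
    (hZm : ∀ i, Measurable (Z i)) (i : ℕ) : pastSigma Z i ≤ mΩ :=
  (measurable_pi_lambda _ fun j : Fin i => hZm j).comap_le

theorem measurable_pastSigma {Ω : Type*} [MeasurableSpace Ω] (Z : ℕ → Ω → ℝ) {i j : ℕ}
    (hj : j < i) : Measurable[pastSigma Z i] (Z j) :=
  (measurable_pi_apply (⟨j, hj⟩ : Fin i)).comp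
    (comap_measurable (fun ω => fun j : Fin i => Z j ω))

theorem integral_exp_neg_mul_sum_log_le {Ω : Type*} [MeasurableSpace Ω] (μ : Measure Ω)
    [IsProbabilityMeasure μ] {R ε b l : ℝ} (hR : 0 ≤ R) (hb : 0 < b) (hl : 0 ≤ l)
    (hlb : 2 * l ≤ b) {k : ℕ} {Z : ℕ → Ω → ℝ} (hZm : ∀ i, Measurable (Z i))
    (hZhalf : ∀ i ω, 1 / 2 < Z i ω) (hZint : ∀ i, Integrable (Z i) μ)
    (hcond : ∀ i < k, ∀ᵐ ω ∂μ, 1 - ε ≤ (μ[Z i | pastSigma Z i]) ω)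
    (htail : ∀ i < k, ∀ t : ℝ, 0 ≤ t →
      ∀ᵐ ω ∂μ, (μ[Set.indicator {ω' | t ≤ |Z i ω' - 1|} (fun _ => (1 : ℝ)) |
        pastSigma Z i]) ω ≤ R * Real.exp (-(2 * b) * t)) :
    ∀ n ≤ k, ∫ ω, Real.exp (-l * ∑ j ∈ range n, Real.log (Z j ω)) ∂μ ≤
      Real.exp (n * (l * ε + (l + 2 * l ^ 2) * (R * (4 / b ^ 2)))) := by
  intro n
  induction n with
  | zero => intro _; simp
  | succ n ih =>
    intro hn
    have hmeas : Measurable[pastSigma Z n] fun ω =>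
        Real.exp (-l * ∑ j ∈ range n, Real.log (Z j ω)) :=
      Real.measurable_exp.comp (Measurable.const_mul (Finset.measurable_fun_sum _ fun j hj =>
        Real.measurable_log.comp (measurable_pastSigma Z (mem_range.1 hj))) _)
    have hbound : ∀ ω, Real.exp (-l * ∑ j ∈ range n, Real.log (Z j ω)) ≤
        Real.exp (-l * ∑ j ∈ range n, Real.log (1 / 2)) := fun ω => by
      rw [Real.exp_le_exp]
      refine mul_le_mul_of_nonpos_left (sum_le_sum fun j _ => ?_) (by linarith)
      exact Real.log_le_log (by norm_num) (hZhalf j ω).le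
    have hstep := integral_mul_exp_neg_mul_log_le (pastSigma_le hZm n) hmeas.stronglyMeasurable
      (fun ω => (Real.exp_pos _).le) hbound (hZm n) (hZhalf n) (hZint n) hR hb hl hlb
      (hcond n hn) (htail n hn)
    simp only [sum_range_succ, mul_add, Real.exp_add] at hstep ⊢
    refine hstep.trans ((mul_le_mul_of_nonneg_left (ih (by omega)) (by positivity)).trans_eq ?_)
    simp only [← Real.exp_add]
    push_cast
    ring_nf

theorem measureReal_prod_le_le {Ω : Type*} [MeasurableSpace Ω] (μ : Measure Ω)
    [IsProbabilityMeasure μ] {l : ℝ} (hl : 0 ≤ l) {k : ℕ} {Z : ℕ → Ω → ℝ}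
    (hZm : ∀ i, Measurable (Z i)) (hZhalf : ∀ i ω, 1 / 2 < Z i ω) :
    μ.real {ω | ∏ i ∈ range k, Z i ω ≤ 0.9} ≤
      Real.exp (-l / 10) * ∫ ω, Real.exp (-l * ∑ j ∈ range k, Real.log (Z j ω)) ∂μ := by
  have hsub : {ω | ∏ i ∈ range k, Z i ω ≤ 0.9} ⊆
      {ω | Real.exp (l / 10) ≤ Real.exp (-l * ∑ j ∈ range k, Real.log (Z j ω))} := by
    intro ω hω
    have hω : ∏ i ∈ range k, Z i ω ≤ 0.9 := hω
    have hpos : ∀ j ∈ range k, 0 < Z j ω := fun j _ => by linarith [hZhalf j ω]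
    have h1 := Real.log_le_sub_one_of_pos (prod_pos hpos)
    rw [Real.log_prod fun j hj => (hpos j hj).ne'] at h1
    show Real.exp _ ≤ Real.exp _
    rw [Real.exp_le_exp]
    norm_num at hω
    nlinarith
  have hint : Integrable (fun ω => Real.exp (-l * ∑ j ∈ range k, Real.log (Z j ω))) μ := by
    refine .of_bound (C := Real.exp (-l * ∑ j ∈ range k, Real.log (1 / 2)))
      (Measurable.aestronglyMeasurable (by fun_prop)) (Filter.Eventually.of_forall fun ω => ?_)
    rw [Real.norm_of_nonneg (Real.exp_pos _).le, Real.exp_le_exp]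
    refine mul_le_mul_of_nonpos_left (sum_le_sum fun j _ => ?_) (by linarith)
    exact Real.log_le_log (by norm_num) (hZhalf j ω).le
  have hmarkov := mul_meas_ge_le_integral_of_nonneg
    (Filter.Eventually.of_forall fun ω => (Real.exp_pos _).le) hint (Real.exp (l / 10))
  have hle := (mul_le_mul_of_nonneg_left (measureReal_mono (μ := μ) hsub)
    (Real.exp_pos (l / 10)).le).trans hmarkov
  rw [neg_div, Real.exp_neg, ← div_eq_inv_mul, le_div_iff₀' (Real.exp_pos _)]
  exact hle

/-- Lower-tail bound for a martingale-like product: if random variables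
`Z 0, …, Z (k-1)` taking values in `(1/2, ∞)` with `k ≤ 1/(1280Rδ²)` satisfy, almost
surely, `E[Z i ∣ Z 0,…,Z (i-1)] ≥ 1 - 1/(40k)` and the conditional tail bound
`Pr[|Z i - 1| ≥ t ∣ Z 0,…,Z (i-1)] ≤ R e^{-t/δ}` for all `t ≥ 0`, then
`Pr[∏ Z i ≤ 0.9] ≤ exp(-1/(160δ) + Rk/2)` when `k < 1/(160Rδ)`, and
`Pr[∏ Z i ≤ 0.9] ≤ exp(-1/(51200Rkδ²))` otherwise. -/
theorem martingale_product_lower_tail {Ω : Type*} [MeasurableSpace Ω] (μ : Measure Ω)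
    [IsProbabilityMeasure μ] (R δ : ℝ) (hR : 0 < R) (hδ : 0 < δ)
    (k : ℕ) (hk : 1 ≤ k) (hkR : (k : ℝ) ≤ 1 / (1280 * R * δ ^ 2))
    (Z : ℕ → Ω → ℝ) (hZm : ∀ i, Measurable (Z i)) (hZhalf : ∀ i ω, 1 / 2 < Z i ω)
    (hZint : ∀ i, Integrable (Z i) μ)
    (hcond : ∀ i < k, ∀ᵐ ω ∂μ, 1 - 1 / (40 * k) ≤ (μ[Z i | pastSigma Z i]) ω)
    (htail : ∀ i < k, ∀ t : ℝ, 0 ≤ t →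
      ∀ᵐ ω ∂μ, (μ[Set.indicator {ω' | t ≤ |Z i ω' - 1|} (fun _ => (1 : ℝ)) |
        pastSigma Z i]) ω ≤ R * Real.exp (-t / δ)) :
    ((k : ℝ) < 1 / (160 * R * δ) →
        (μ {ω | ∏ i ∈ range k, Z i ω ≤ 0.9}).toReal
          ≤ Real.exp (-1 / (160 * δ) + R * k / 2)) ∧
    (¬ ((k : ℝ) < 1 / (160 * R * δ)) →
        (μ {ω | ∏ i ∈ range k, Z i ω ≤ 0.9}).toReal
          ≤ Real.exp (-1 / (51200 * R * k * δ ^ 2))) := by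
  have hk0 : (0 : ℝ) < k := by exact_mod_cast hk
  have hkδ : R * k * δ ^ 2 ≤ 1 / 1280 := by
    rw [le_div_iff₀ (by positivity)] at hkR
    linarith
  have key : ∀ l : ℝ, 0 ≤ l → 4 * δ * l ≤ 1 →
      (μ {ω | ∏ i ∈ range k, Z i ω ≤ 0.9}).toReal ≤
        Real.exp (-l / 16 + 32 * l ^ 2 * (R * k * δ ^ 2)) := by
    intro l hl hlδ
    have hE := integral_exp_neg_mul_sum_log_le μ (ε := 1 / (40 * k)) (b := 1 / (2 * δ)) hR.le
      (by positivity) hl (by rw [le_div_iff₀ (by positivity)]; linarith) hZm hZhalf hZint hcond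
      (fun i hi t ht => by
        convert htail i hi t ht using 5
        field_simp) k le_rfl
    refine (measureReal_prod_le_le μ hl hZm hZhalf).trans
      ((mul_le_mul_of_nonneg_left hE (Real.exp_pos _).le).trans ?_)
    rw [← Real.exp_add, Real.exp_le_exp]
    have heq : (k : ℝ) * (l * (1 / (40 * k)) +
        (l + 2 * l ^ 2) * (R * (4 / (1 / (2 * δ)) ^ 2))) =
        l / 40 + 16 * l * (R * k * δ ^ 2) + 32 * l ^ 2 * (R * k * δ ^ 2) := by
      field_simp
      ring
    rw [heq]
    nlinarith [mul_le_mul_of_nonneg_left hkδ hl]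
  refine ⟨fun hsmall => ?_, fun hlarge => ?_⟩
  · refine (key (1 / (4 * δ)) (by positivity) (by field_simp; rfl)).trans
      (Real.exp_le_exp.2 ?_)
    rw [lt_div_iff₀ (by positivity)] at hsmall
    have h1 : R * k ≤ 1 / (160 * δ) := by
      rw [le_div_iff₀ (by positivity)]
      linarith
    have h2 : -(1 / (4 * δ)) / 16 + 32 * (1 / (4 * δ)) ^ 2 * (R * k * δ ^ 2) =
        -(5 / 2) * (1 / (160 * δ)) + 2 * (R * k) := by
      field_simp
      ring
    rw [h2, neg_div]
    linarith
  · refine (key (1 / (1024 * (R * k * δ ^ 2))) (by positivity) ?_).trans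
      (Real.exp_le_exp.2 ?_)
    · rw [not_lt, div_le_iff₀ (by positivity)] at hlarge
      rw [mul_one_div, div_le_one (by positivity)]
      nlinarith
    · have h1 : -(1 / (1024 * (R * k * δ ^ 2))) / 16 +
          32 * (1 / (1024 * (R * k * δ ^ 2))) ^ 2 * (R * k * δ ^ 2) =
          -(1 / 32768) * (1 / (R * k * δ ^ 2)) := by
        field_simp
        norm_num
      have h2 : -1 / (51200 * R * k * δ ^ 2) = -(1 / 51200) * (1 / (R * k * δ ^ 2)) := by
        field_simp
      have h3 : 0 < 1 / (R * k * δ ^ 2) := by positivity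
      rw [h1, h2]
      nlinarith
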